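/- Let λ ∈ ℂ with Re λ < 0 and Im λ ≠ 0 be a root of λ² + λw + s² = 0 where w ∈ ℂ satisfies Re w > 0, |Im w| ≤ k·Re w (k ≥ 0), and 0 ≤ s ≤ (1/μ)·Re w for some μ > 0. Then (Im λ)²/(Re λ)² ≤ k_μ², where k_μ² = 2/μ² + (k²-1)/2 + sqrt((2/μ² + (k²-1)/2)² + k²). -/

import Mathlib

/-- The positive root bounds every point where the quadratic `X ^ 2 - 2 * c * X - d` is nonpositive. -/
lemma le_add_sqrt_of_sq_le {X c d : ℝ} (h : X ^ 2 ≤ 2 * c * X + d) :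
    X ≤ c + Real.sqrt (c ^ 2 + d) := by
  have h₁ : X - c ≤ Real.sqrt (c ^ 2 + d) := Real.le_sqrt_of_sq_le (by linarith)
  linarith

/-- A relation between the root `x + y * I` of `z ^ 2 + z * (p + q * I) + s ^ 2` and the
coefficients, obtained by separating real and imaginary parts. -/
lemma im_sq_mul_normSq_eq {x y p q s : ℝ}
    (h_re : x ^ 2 - y ^ 2 + (x * p - y * q) + s ^ 2 = 0)
    (h_im : 2 * x * y + (x * q + y * p) = 0) :
    y ^ 2 * p ^ 2 * (x ^ 2 + y ^ 2) =
      x ^ 2 * q ^ 2 * (x ^ 2 + y ^ 2) + 4 * x ^ 2 * y ^ 2 * s ^ 2 := by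
  have hp : (x ^ 2 + y ^ 2) * p = -x * (x ^ 2 + y ^ 2 + s ^ 2) := by
    linear_combination x * h_re + y * h_im
  have hq : (x ^ 2 + y ^ 2) * q = -y * (x ^ 2 + y ^ 2 - s ^ 2) := by
    linear_combination x * h_im - y * h_re
  linear_combination (x ^ 2 + y ^ 2) * (y * p - x * q) * h_im
    - 2 * x * y * (y * hp - x * hq)

/-- algebraic core of Theorem 6.2 (ii). -/
theorem stmt_5 (k μ : ℝ) (hk : 0 ≤ k) (hμ : 0 < μ)
    (w : ℂ) (hw : 0 < w.re) (hsec : |w.im| ≤ k * w.re)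
    (s : ℝ) (hs0 : 0 ≤ s) (hs : s ≤ (1 / μ) * w.re)
    (lam : ℂ) (heq : lam ^ 2 + lam * w + (s : ℂ) ^ 2 = 0)
    (hre : lam.re < 0) (him : lam.im ≠ 0) :
    lam.im ^ 2 / lam.re ^ 2 ≤
      2 / μ ^ 2 + (k ^ 2 - 1) / 2 +
        Real.sqrt ((2 / μ ^ 2 + (k ^ 2 - 1) / 2) ^ 2 + k ^ 2) := by
  obtain ⟨x, y⟩ := lam
  obtain ⟨p, q⟩ := w
  have h_re := congrArg Complex.re heq
  have h_im := congrArg Complex.im heq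
  simp only [pow_two, Complex.add_re, Complex.add_im, Complex.mul_re, Complex.mul_im,
    Complex.ofReal_re, Complex.ofReal_im, Complex.zero_re, Complex.zero_im] at h_re h_im
  dsimp only at *
  have key := im_sq_mul_normSq_eq (x := x) (y := y) (p := p) (q := q) (s := s)
    (by linarith) (by linarith)
  have hq : q ^ 2 ≤ k ^ 2 * p ^ 2 := by
    rw [← mul_pow]
    exact sq_le_sq' (abs_le.mp hsec).1 (abs_le.mp hsec).2
  have hs2 : s ^ 2 ≤ 1 / μ ^ 2 * p ^ 2 := by
    calc s ^ 2 ≤ (1 / μ * p) ^ 2 := pow_le_pow_left₀ hs0 hs 2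
      _ = 1 / μ ^ 2 * p ^ 2 := by ring
  have hbound : y ^ 2 * (x ^ 2 + y ^ 2) ≤
      k ^ 2 * x ^ 2 * (x ^ 2 + y ^ 2) + 4 * (1 / μ ^ 2) * x ^ 2 * y ^ 2 := by
    refine le_of_mul_le_mul_right ?_ (pow_pos hw 2)
    have h₁ := mul_le_mul_of_nonneg_left hq (by positivity : 0 ≤ x ^ 2 * (x ^ 2 + y ^ 2))
    have h₂ := mul_le_mul_of_nonneg_left hs2 (by positivity : 0 ≤ 4 * x ^ 2 * y ^ 2)
    linarith
  apply le_add_sqrt_of_sq_le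
  have hx : x ≠ 0 := hre.ne
  have hx4 : 0 < x ^ 4 := by positivity
  refine le_of_mul_le_mul_right ?_ hx4
  have hl : (y ^ 2 / x ^ 2) ^ 2 * x ^ 4 = y ^ 4 := by field_simp
  have hr : (2 * (2 / μ ^ 2 + (k ^ 2 - 1) / 2) * (y ^ 2 / x ^ 2) + k ^ 2) * x ^ 4 =
      (4 * (1 / μ ^ 2) + k ^ 2 - 1) * y ^ 2 * x ^ 2 + k ^ 2 * x ^ 4 := by
    field_simp
    ring
  rw [hl, hr]
  linarith
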